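/- Let j ≤ N be positive integers and let q, x be complex numbers such that q^i ≠ 1 for 1 ≤ i ≤ N and x q^{j+i} ≠ 1 for 0 ≤ i ≤ N − j. Then 1 / ∏_{i=0}^{N−j} (1 − x q^{j+i}) = Σ_{i=j}^{N} x^i q^{i²} / ( ∏_{l=0}^{i−j} (1 − x q^{j+l}) ) · [N choose i]_q + Σ_{i=0}^{j−1} x^i q^{i·j} · [N−j+i choose i]_q. -/

import Mathlib

open scoped BigOperators

/-- The finite q-Pochhammer symbol `(a;q)_n = ∏_{i=0}^{n-1} (1 - a q^i)`. -/
noncomputable def qPoch (a q : ℂ) (n : ℕ) : ℂ := ∏ i ∈ Finset.range n, (1 - a * q ^ i)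

/-- The Gaussian (q-binomial) coefficient `[n choose k]_q`, equal to
`(q;q)_n / ((q;q)_{n-k} (q;q)_k)` when `0 ≤ k ≤ n` and `0` otherwise. -/
noncomputable def qBinom (q : ℂ) (n k : ℤ) : ℂ :=
  if 0 ≤ k ∧ k ≤ n then
    qPoch q q n.toNat / (qPoch q q (n - k).toNat * qPoch q q k.toNat)
  else 0

/-- The Gaussian coefficient `[a+b choose b]_q`, indexed by natural numbers. -/
noncomputable def gaussCoeff (q : ℂ) (a b : ℕ) : ℂ :=
  qPoch q q (a + b) / (qPoch q q a * qPoch q q b)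

lemma qBinom_eq_gaussCoeff (q : ℂ) {n k : ℤ} (a b : ℕ) (hn : n = a + b) (hk : k = b) :
    qBinom q n k = gaussCoeff q a b := by
  subst hn hk
  rw [qBinom, if_pos ⟨by omega, by omega⟩, gaussCoeff, add_sub_cancel_right]
  congr

lemma qPoch_zero (a q : ℂ) : qPoch a q 0 = 1 := by simp [qPoch]

lemma qPoch_one (a q : ℂ) : qPoch a q 1 = 1 - a := by simp [qPoch]

lemma qPoch_succ (a q : ℂ) (n : ℕ) : qPoch a q (n + 1) = qPoch a q n * (1 - a * q ^ n) :=
  Finset.prod_range_succ _ _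

lemma qPoch_succ' (a q : ℂ) (n : ℕ) : qPoch a q (n + 1) = (1 - a) * qPoch (a * q) q n := by
  simp only [qPoch, Finset.prod_range_succ', pow_zero, mul_one, pow_succ', mul_assoc]
  ring

lemma qPoch_self_ne_zero {q : ℂ} {N n : ℕ} (hq : ∀ i : ℕ, 1 ≤ i → i ≤ N → q ^ i ≠ 1)
    (hn : n ≤ N) : qPoch q q n ≠ 0 := by
  refine Finset.prod_ne_zero_iff.2 fun i hi => ?_
  rw [← pow_succ', sub_ne_zero]
  exact (hq _ (by omega) (by have := Finset.mem_range.1 hi; omega)).symm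

lemma gaussCoeff_zero_right {q : ℂ} {a : ℕ} (ha : qPoch q q a ≠ 0) : gaussCoeff q a 0 = 1 := by
  simp [gaussCoeff, qPoch_zero, ha]

lemma gaussCoeff_zero_left {q : ℂ} {b : ℕ} (hb : qPoch q q b ≠ 0) : gaussCoeff q 0 b = 1 := by
  simp [gaussCoeff, qPoch_zero, hb]

lemma gaussCoeff_pascal {q : ℂ} {a b : ℕ} (ha : qPoch q q (a + 1) ≠ 0)
    (hb : qPoch q q (b + 1) ≠ 0) :
    gaussCoeff q (a + 1) (b + 1) =
      q ^ (b + 1) * gaussCoeff q a (b + 1) + gaussCoeff q (a + 1) b := by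
  rw [qPoch_succ] at ha hb
  obtain ⟨ha, ha'⟩ := mul_ne_zero_iff.1 ha
  obtain ⟨hb, hb'⟩ := mul_ne_zero_iff.1 hb
  simp only [gaussCoeff, show a + 1 + (b + 1) = a + b + 1 + 1 by ring,
    show a + (b + 1) = a + b + 1 by ring, show a + 1 + b = a + b + 1 by ring,
    qPoch_succ q q (a + b + 1), qPoch_succ q q a, qPoch_succ q q b]
  field_simp
  ring

lemma sum_gaussCoeff_succ {q : ℂ} (x : ℂ) {N d : ℕ}
    (hq : ∀ i : ℕ, 1 ≤ i → i ≤ N → q ^ i ≠ 1) (hd : d + 1 ≤ N) (k m : ℕ) (hm : m ≤ N) :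
    ∑ i ∈ Finset.range (m + 1), x ^ i * q ^ (i * (k + 1)) * gaussCoeff q d i =
      x ^ m * q ^ (m * k) * gaussCoeff q (d + 1) m +
        (1 - x * q ^ k) * ∑ i ∈ Finset.range m, x ^ i * q ^ (i * k) * gaussCoeff q (d + 1) i := by
  induction m with
  | zero =>
    simp [gaussCoeff_zero_right (qPoch_self_ne_zero hq hd),
      gaussCoeff_zero_right (qPoch_self_ne_zero hq (Nat.le_of_succ_le hd))]
  | succ m ih =>
    rw [Finset.sum_range_succ, ih (by omega), Finset.sum_range_succ _ m,
      gaussCoeff_pascal (qPoch_self_ne_zero hq hd) (qPoch_self_ne_zero hq hm)]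
    ring

lemma durfee_dissection {q : ℂ} (x : ℂ) {N : ℕ} (hq : ∀ i : ℕ, 1 ≤ i → i ≤ N → q ^ i ≠ 1)
    (d j : ℕ) (hN : j + d = N) (hx : ∀ i : ℕ, i ≤ d → x * q ^ (j + i) ≠ 1) :
    1 / qPoch (x * q ^ j) q (d + 1) =
      (∑ k ∈ Finset.range (d + 1), x ^ (j + k) * q ^ ((j + k) ^ 2) /
          qPoch (x * q ^ j) q (k + 1) * gaussCoeff q (d - k) (j + k)) +
        ∑ i ∈ Finset.range j, x ^ i * q ^ (i * j) * gaussCoeff q d i := by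
  have hxj : 1 - x * q ^ j ≠ 0 := sub_ne_zero.2 (hx 0 (Nat.zero_le _)).symm
  induction d generalizing j with
  | zero =>
    have hgeom : ∑ i ∈ Finset.range j, x ^ i * q ^ (i * j) * gaussCoeff q 0 i =
        ∑ i ∈ Finset.range j, (x * q ^ j) ^ i := by
      refine Finset.sum_congr rfl fun i hi => ?_
      have := Finset.mem_range.1 hi
      rw [gaussCoeff_zero_left (qPoch_self_ne_zero hq (by omega))]
      ring
    have hmul := mul_neg_geom_sum (x * q ^ j) j
    rw [hgeom, Finset.sum_range_one, zero_add, qPoch_one, Nat.sub_zero, add_zero,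
      gaussCoeff_zero_left (qPoch_self_ne_zero hq (by omega))]
    field_simp
    rw [hmul]
    ring
  | succ d ih =>
    have ih' := ih (j + 1) (by omega)
      (fun i hi => by simpa only [add_assoc, add_comm 1 i] using hx (i + 1) (by omega))
      (sub_ne_zero.2 (hx 1 (by omega)).symm)
    rw [sum_gaussCoeff_succ x hq (by omega) j j (by omega)] at ih'
    have hshift : ∀ n, qPoch (x * q ^ j) q (n + 1) =
        (1 - x * q ^ j) * qPoch (x * q ^ (j + 1)) q n := fun n => by
      rw [qPoch_succ', pow_succ, mul_assoc]
    have hsum : ∑ k ∈ Finset.range (d + 1), x ^ (j + (k + 1)) * q ^ ((j + (k + 1)) ^ 2) /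
          qPoch (x * q ^ j) q (k + 1 + 1) * gaussCoeff q (d + 1 - (k + 1)) (j + (k + 1)) =
        (∑ k ∈ Finset.range (d + 1), x ^ (j + 1 + k) * q ^ ((j + 1 + k) ^ 2) /
          qPoch (x * q ^ (j + 1)) q (k + 1) * gaussCoeff q (d - k) (j + 1 + k)) /
          (1 - x * q ^ j) := by
      rw [Finset.sum_div]
      refine Finset.sum_congr rfl fun k _ => ?_
      rw [hshift, Nat.add_sub_add_right, show j + (k + 1) = j + 1 + k by ring,
        mul_comm (1 - x * q ^ j), ← div_div, div_mul_eq_mul_div _ (1 - x * q ^ j)]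
    rw [Finset.sum_range_succ', hsum, hshift (d + 1), mul_comm (1 - x * q ^ j), ← div_div, ih',
      zero_add, qPoch_one, Nat.sub_zero, add_zero]
    field_simp
    ring

/-- Durfee-square dissection of the generating function for partitions with parts in
`{j, j+1, …, N}`: for positive integers `j ≤ N` and `q, x` with `q^i ≠ 1` for
`1 ≤ i ≤ N` and `xq^{j+i} ≠ 1` for `0 ≤ i ≤ N − j`,
`1/(xq^j;q)_{N−j+1} = Σ_{i=j}^N x^i q^{i²}/(xq^j;q)_{i−j+1} [N choose i]_q
  + Σ_{i=0}^{j−1} x^i q^{ij} [N−j+i choose i]_q`. -/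
theorem stmt12 (N j : ℕ) (hj : 1 ≤ j) (hjN : j ≤ N) (q x : ℂ)
    (hq : ∀ i : ℕ, 1 ≤ i → i ≤ N → q ^ i ≠ 1)
    (hx : ∀ i : ℕ, i ≤ N - j → x * q ^ (j + i) ≠ 1) :
    1 / qPoch (x * q ^ j) q (N - j + 1)
    = (∑ i ∈ Finset.Icc j N,
        x ^ i * q ^ (i ^ 2) / qPoch (x * q ^ j) q (i - j + 1) * qBinom q N i)
      + ∑ i ∈ Finset.range j, x ^ i * q ^ (i * j) * qBinom q (N - j + i) i := by
  obtain ⟨d, rfl⟩ := Nat.exists_eq_add_of_le hjN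
  rw [Nat.add_sub_cancel_left] at hx ⊢
  rw [durfee_dissection x hq d j rfl hx, ← Finset.Ico_add_one_right_eq_Icc,
    Finset.sum_Ico_eq_sum_range, show j + d + 1 - j = d + 1 by omega]
  congr 1
  · refine Finset.sum_congr rfl fun k hk => ?_
    have := Finset.mem_range.1 hk
    rw [Nat.add_sub_cancel_left, qBinom_eq_gaussCoeff q (d - k) (j + k) (by omega) rfl]
  · refine Finset.sum_congr rfl fun i _ => ?_
    rw [qBinom_eq_gaussCoeff q d i (by push_cast; ring) rfl]
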